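/- Fix integers m ≥ 2 and k ≥ 2, and let i ∈ {1,…,m−1} satisfy gcd(i,m) = 1. Then r_ℳ(i,m,k) = φ(m)^{k−2}·m, where φ is Euler's totient function; in particular the natural density of {n ∈ ℕ : p_ℳ(n,k) ≡ i (mod m)} equals φ(m)^{k−2}/m^{k−1}. -/

import Mathlib

open Filter

/-- `pM m k n` is the number of restricted `m`-ary partitions of `n` with parts
`1, m, m^2, …, m^(k-1)`. -/
noncomputable def pM (m k n : ℕ) : ℕ :=
  Nat.card {x : Fin k → ℕ // ∑ i : Fin k, x i * m ^ (i : ℕ) = n}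

/-- `rM i m k = #{n ∈ {0,…,m^k - 1} : p_ℳ(n,k) ≡ i (mod m)}`. -/
noncomputable def rM (i m k : ℕ) : ℕ :=
  ((Finset.range (m ^ k)).filter (fun n : ℕ => pM m k n % m = i)).card

theorem sum_mul_pow_succ (m k : ℕ) (x : Fin (k + 1) → ℕ) :
    ∑ i : Fin (k + 1), x i * m ^ (i : ℕ) =
      x 0 + m * ∑ i : Fin k, x i.succ * m ^ (i : ℕ) := by
  rw [Fin.sum_univ_succ, Finset.mul_sum]
  simp only [Fin.val_zero, pow_zero, mul_one, Fin.val_succ]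
  congr 1
  exact Finset.sum_congr rfl fun i _ => by ring

/-- Removing the parts equal to `1` from a restricted `m`-ary partition of `n` and dividing by `m`
leaves a restricted `m`-ary partition of some `j ≤ n / m`. -/
def restrictedPartitionEquiv (m k n : ℕ) (hm : 0 < m) :
    {x : Fin (k + 1) → ℕ // ∑ i : Fin (k + 1), x i * m ^ (i : ℕ) = n} ≃
      (j : Fin (n / m + 1)) × {y : Fin k → ℕ // ∑ i : Fin k, y i * m ^ (i : ℕ) = j} where
  toFun x := ⟨⟨∑ i : Fin k, x.1 i.succ * m ^ (i : ℕ), by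
    have h := x.2
    rw [sum_mul_pow_succ] at h
    rw [Nat.lt_succ_iff, Nat.le_div_iff_mul_le hm, mul_comm]
    omega⟩, ⟨fun i => x.1 i.succ, rfl⟩⟩
  invFun y := ⟨Fin.cons (n - m * y.1) y.2.1, by
    have h := Nat.lt_succ_iff.1 y.1.2
    rw [Nat.le_div_iff_mul_le hm, mul_comm] at h
    rw [sum_mul_pow_succ]
    simp only [Fin.cons_zero, Fin.cons_succ, y.2.2]
    omega⟩
  left_inv x := by
    have h := x.2
    rw [sum_mul_pow_succ] at h
    ext i
    refine Fin.cases ?_ (fun i => ?_) i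
    · simp only [Fin.cons_zero]
      omega
    · simp
  right_inv := by
    rintro ⟨⟨j, hj⟩, ⟨y, hy⟩⟩
    dsimp only at hy
    subst hy
    rfl

theorem finite_restrictedPartition (m k n : ℕ) (hm : 0 < m) :
    Finite {x : Fin k → ℕ // ∑ i : Fin k, x i * m ^ (i : ℕ) = n} := by
  induction k generalizing n with
  | zero => infer_instance
  | succ k ih =>
    have := fun j => ih j
    exact Finite.of_equiv _ (restrictedPartitionEquiv m k n hm).symm

theorem pM_succ (m k n : ℕ) (hm : 0 < m) :
    pM m (k + 1) n = ∑ j ∈ Finset.range (n / m + 1), pM m k j := by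
  have := fun j => finite_restrictedPartition m k j hm
  rw [pM, Nat.card_congr (restrictedPartitionEquiv m k n hm), Nat.card_sigma,
    ← Fin.sum_univ_eq_sum_range]
  rfl

theorem pM_zero (m n : ℕ) : pM m 0 n = if n = 0 then 1 else 0 := by
  rw [pM]
  split_ifs with h
  · subst h
    simp
  · have : IsEmpty {x : Fin 0 → ℕ // ∑ i : Fin 0, x i * m ^ (i : ℕ) = n} :=
      ⟨fun x => h (by simpa using x.2.symm)⟩
    exact Nat.card_of_isEmpty

theorem pM_one (m n : ℕ) (hm : 0 < m) : pM m 1 n = 1 := by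
  simp [pM_succ m 0 n hm, pM_zero]

/-- The product of `d + 1` modulo `m` over the last `k` base-`m` digits `d` of `t`. -/
def digitProd (m : ℕ) : ℕ → ℕ → ZMod m
  | 0, _ => 1
  | k + 1, t => ((t : ZMod m) + 1) * digitProd m k (t / m)

theorem sum_range_mul_eq {M : Type*} [AddCommMonoid M] (m K : ℕ) (g : ℕ → M) :
    ∑ n ∈ Finset.range (m * K), g n =
      ∑ t ∈ Finset.range K, ∑ a ∈ Finset.range m, g (m * t + a) := by
  induction K with
  | zero => simp
  | succ K ih => rw [Nat.mul_succ, Finset.sum_range_add, ih, Finset.sum_range_succ]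

theorem mul_add_div_of_lt {m a : ℕ} (t : ℕ) (ha : a < m) : (m * t + a) / m = t := by
  rw [Nat.mul_add_div (by omega), Nat.div_eq_of_lt ha, add_zero]

theorem pM_eq_digitProd (m k n : ℕ) (hm : 0 < m) :
    (pM m (k + 1) n : ZMod m) = digitProd m k (n / m) := by
  induction k generalizing n with
  | zero => simp [pM_one m n hm, digitProd]
  | succ k ih =>
    rw [pM_succ m _ n hm, Nat.cast_sum, Finset.sum_congr rfl fun j _ => ih j, digitProd]
    generalize n / m = q
    have hb := Nat.mod_lt q hm
    conv_lhs => rw [← Nat.div_add_mod q m, add_assoc, Finset.sum_range_add, sum_range_mul_eq]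
    have h₁ : ∀ t, ∑ a ∈ Finset.range m, digitProd m k ((m * t + a) / m) = 0 := fun t => by
      rw [Finset.sum_congr rfl fun a ha => by
        rw [mul_add_div_of_lt t (Finset.mem_range.1 ha)]]
      simp
    have h₂ : ∑ a ∈ Finset.range (q % m + 1), digitProd m k ((m * (q / m) + a) / m) =
        ((q : ZMod m) + 1) * digitProd m k (q / m) := by
      rw [Finset.sum_congr rfl fun a ha => by
        rw [mul_add_div_of_lt (q / m) (by have := Finset.mem_range.1 ha; omega)]]
      simp
    simp [h₁, h₂]

theorem sum_range_cast_zmod {M : Type*} [AddCommMonoid M] (m : ℕ) [NeZero m] (f : ZMod m → M) :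
    ∑ a ∈ Finset.range m, f a = ∑ x : ZMod m, f x := by
  refine Finset.sum_bij' (fun a _ => (a : ZMod m)) (fun x _ => x.val) ?_ ?_ ?_ ?_ ?_
  · simp
  · exact fun x _ => Finset.mem_range.2 x.val_lt
  · exact fun a ha => ZMod.val_cast_of_lt (Finset.mem_range.1 ha)
  · simp
  · simp

theorem sum_range_cast_add_one_zmod {M : Type*} [AddCommMonoid M] (m : ℕ) [NeZero m]
    (f : ZMod m → M) : ∑ a ∈ Finset.range m, f ((a : ZMod m) + 1) = ∑ x : ZMod m, f x := by
  rw [sum_range_cast_zmod m fun x => f (x + 1)]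
  exact Equiv.sum_comp (Equiv.addRight (1 : ZMod m)) f

theorem sum_ite_isUnit_zmod (m : ℕ) [NeZero m] (c : ℕ) :
    (∑ x : ZMod m, open Classical in if IsUnit x then c else 0) = Nat.totient m * c := by
  classical
  rw [← Finset.sum_filter, Finset.sum_const, smul_eq_mul, ← ZMod.card_units_eq_totient,
    ← Fintype.card_subtype]
  congr 1
  exact Fintype.card_congr Submonoid.unitsTypeEquivIsUnitSubmonoid.toEquiv.symm

theorem sum_digitProd_eq (m k : ℕ) [NeZero m] (u : (ZMod m)ˣ) :
    (∑ t ∈ Finset.range (m ^ (k + 1)), if digitProd m (k + 1) t = u then 1 else 0) =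
      Nat.totient m ^ k := by
  classical
  induction k generalizing u with
  | zero =>
    simp only [zero_add, pow_one, digitProd, mul_one, pow_zero]
    rw [sum_range_cast_add_one_zmod m fun x => if x = (u : ZMod m) then 1 else 0]
    simp
  | succ k ih =>
    rw [pow_succ' m, sum_range_mul_eq, Finset.sum_comm]
    have h : ∀ a ∈ Finset.range m,
        (∑ t ∈ Finset.range (m ^ (k + 1)),
          if digitProd m (k + 1 + 1) (m * t + a) = u then 1 else 0) =
        if IsUnit ((a : ZMod m) + 1) then Nat.totient m ^ k else 0 := by
      intro a ha
      have ha' := Finset.mem_range.1 ha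
      have hd : ∀ t, digitProd m (k + 1 + 1) (m * t + a) =
          ((a : ZMod m) + 1) * digitProd m (k + 1) t := fun t => by
        rw [digitProd, mul_add_div_of_lt t ha']
        simp
      simp only [hd]
      split_ifs with hu
      · obtain ⟨v, hv⟩ := hu
        rw [← hv, ← ih (v⁻¹ * u)]
        refine Finset.sum_congr rfl fun t _ => ?_
        simp only [Units.val_mul, Units.eq_inv_mul_iff_mul_eq]
      · refine Finset.sum_eq_zero fun t _ => if_neg fun h => hu ?_
        exact isUnit_of_mul_isUnit_left (h ▸ u.isUnit)
    rw [Finset.sum_congr rfl h, sum_range_cast_add_one_zmod m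
      fun x => if IsUnit x then Nat.totient m ^ k else 0, sum_ite_isUnit_zmod, pow_succ']

theorem digitProd_add_pow (m k t : ℕ) (hm : 0 < m) :
    digitProd m k (t + m ^ k) = digitProd m k t := by
  induction k generalizing t with
  | zero => rfl
  | succ k ih =>
    rw [digitProd, digitProd, pow_succ', Nat.add_mul_div_left _ _ hm, ih]
    simp

theorem count_mul_of_periodic {p : ℕ → Prop} [DecidablePred p] {M : ℕ}
    (hp : Function.Periodic p M) (q : ℕ) : Nat.count p (M * q) = q * Nat.count p M := by
  induction q with
  | zero => simp
  | succ q ih =>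
    have h : (fun k => p (M * q + k)) = p := funext fun k => by
      rw [add_comm, mul_comm]
      exact hp.nat_mul q k
    rw [Nat.mul_succ, Nat.count_add, ih, Nat.succ_mul]
    simp only [h]

theorem tendsto_count_div_of_periodic {p : ℕ → Prop} [DecidablePred p] {M : ℕ} (hM : 0 < M)
    (hp : Function.Periodic p M) :
    Tendsto (fun N : ℕ => (Nat.count p (N + 1) : ℝ) / N) atTop
      (nhds ((Nat.count p M : ℝ) / M)) := by
  set r := Nat.count p M with hr
  have hM' : (0 : ℝ) < M := by exact_mod_cast hM
  have hlim : Tendsto (fun N : ℕ => ((2 * r : ℕ) : ℝ) / N) atTop (nhds 0) :=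
    tendsto_const_div_atTop_nhds_zero_nat _
  rw [tendsto_iff_dist_tendsto_zero]
  refine squeeze_zero' (Eventually.of_forall fun _ => dist_nonneg) ?_ hlim
  filter_upwards [eventually_gt_atTop 0] with N hN
  have hN' : (0 : ℝ) < N := by exact_mod_cast hN
  have hlo : (N + 1) / M * r ≤ Nat.count p (N + 1) := by
    rw [hr, ← count_mul_of_periodic hp]
    exact Nat.count_monotone p (Nat.mul_div_le _ _)
  have hhi : Nat.count p (N + 1) ≤ ((N + 1) / M + 1) * r := by
    rw [hr, ← count_mul_of_periodic hp]
    exact Nat.count_monotone p (Nat.lt_mul_div_succ _ hM).le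
  have h₁ : M * ((N + 1) / M) ≤ N + 1 := Nat.mul_div_le _ _
  have h₂ : N + 1 < M * ((N + 1) / M + 1) := Nat.lt_mul_div_succ _ hM
  generalize (N + 1) / M = q at *
  generalize Nat.count p (N + 1) = c at *
  have hlo' : (q : ℝ) * r ≤ c := by exact_mod_cast hlo
  have hhi' : (c : ℝ) ≤ (q + 1) * r := by exact_mod_cast hhi
  have h₁' : (M : ℝ) * q ≤ N + 1 := by exact_mod_cast h₁
  have h₂' : (N : ℝ) + 1 ≤ M * (q + 1) := by exact_mod_cast h₂.le
  have hr0 : (0 : ℝ) ≤ r := by positivity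
  have hM1 : (1 : ℝ) ≤ M := by exact_mod_cast hM
  have e : (c : ℝ) / N - r / M = (c * M - r * N) / M / N := by
    field_simp
  rw [Real.dist_eq, e, abs_div, abs_of_pos hN', abs_div, abs_of_pos hM']
  gcongr
  rw [div_le_iff₀ hM', abs_le]
  push_cast
  constructor
  · nlinarith [mul_le_mul_of_nonneg_right hlo' hM'.le, mul_le_mul_of_nonneg_left h₂' hr0,
      mul_nonneg hr0 hM'.le]
  · nlinarith [mul_le_mul_of_nonneg_right hhi' hM'.le, mul_le_mul_of_nonneg_left h₁' hr0,
      mul_le_mul_of_nonneg_left hM1 hr0]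

theorem pM_mod_eq_iff {m i : ℕ} (k n : ℕ) (hi : i < m) :
    pM m (k + 1) n % m = i ↔ digitProd m k (n / m) = i := by
  rw [← pM_eq_digitProd m k n (by omega), ZMod.natCast_eq_natCast_iff', Nat.mod_eq_of_lt hi]

theorem rM_eq_of_coprime {m i : ℕ} (k : ℕ) (hi : i < m) (h : Nat.Coprime i m) :
    rM i m (k + 2) = Nat.totient m ^ k * m := by
  have : NeZero m := ⟨by omega⟩
  rw [rM, Finset.card_filter, pow_succ', sum_range_mul_eq,
    ← sum_digitProd_eq m k (ZMod.unitOfCoprime i h), Finset.sum_mul]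
  refine Finset.sum_congr rfl fun t _ => ?_
  rw [Finset.sum_congr rfl fun a ha => by
    rw [if_congr (pM_mod_eq_iff (k + 1) (m * t + a) hi) rfl rfl,
      mul_add_div_of_lt t (Finset.mem_range.1 ha)]]
  rw [Finset.sum_const, Finset.card_range, smul_eq_mul, mul_comm, ZMod.coe_unitOfCoprime]

theorem pM_mod_eq_periodic {m i : ℕ} (k : ℕ) (hi : i < m) :
    Function.Periodic (fun n => pM m (k + 1) n % m = i) (m ^ (k + 1)) := fun n => by
  simp only [pM_mod_eq_iff k _ hi]
  rw [pow_succ', Nat.add_mul_div_left _ _ (by omega), digitProd_add_pow m k _ (by omega)]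

theorem stmt_17 (m k : ℕ) (hm : 2 ≤ m) (hk : 2 ≤ k) (i : ℕ)
    (hi1 : 1 ≤ i) (hi2 : i ≤ m - 1) (hgcd : Nat.gcd i m = 1) :
    rM i m k = Nat.totient m ^ (k - 2) * m ∧
    Tendsto (fun N : ℕ =>
        (((Finset.range (N + 1)).filter (fun n : ℕ => pM m k n % m = i)).card : ℝ) / N)
      atTop (nhds ((Nat.totient m : ℝ) ^ (k - 2) / (m : ℝ) ^ (k - 1))) := by
  obtain ⟨k, rfl⟩ := Nat.exists_eq_add_of_le' hk
  have hi : i < m := by omega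
  have hm' : (m : ℝ) ≠ 0 := by exact_mod_cast (by omega : m ≠ 0)
  have hr := rM_eq_of_coprime k hi hgcd
  refine ⟨hr, ?_⟩
  have h := tendsto_count_div_of_periodic (pow_pos (by omega) _) (pM_mod_eq_periodic (k + 1) hi)
  simp only [Nat.count_eq_card_filter_range] at h
  rw [rM] at hr
  rw [hr] at h
  convert h using 2
  rw [show k + 2 - 1 = k + 1 by omega, Nat.add_sub_cancel, pow_succ _ (k + 1)]
  push_cast
  field_simp
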